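/- arXiv:1312.0667 — 2 statements merged into one kernel-verified Lean document; each statement's English description precedes it below -/
import Mathlib

section
/- Let m₁, n₁, m₂, n₂ be integers such that m₁ and n₁ are coprime, and set k = |m₁·n₂ − n₁·m₂|. Then the group with presentation ⟨g₁, g₂ ∣ g₁^{n₁} = g₂^{n₂}, g₁^{m₁} = g₂^{m₂}⟩ is isomorphic to the cyclic group ℤ/kℤ (with the convention ℤ/0ℤ = ℤ, so the group is infinite cyclic when m₁·n₂ = n₁·m₂). -/
/-- The relators `g₁^{n₁} g₂^{-n₂}` and `g₁^{m₁} g₂^{-m₂}` in the free group on two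
generators, where `g₁ = FreeGroup.of true` and `g₂ = FreeGroup.of false`. -/
def diskBundleRels (m₁ n₁ m₂ n₂ : ℤ) : Set (FreeGroup Bool) :=
  {FreeGroup.of true ^ n₁ * (FreeGroup.of false ^ n₂)⁻¹,
   FreeGroup.of true ^ m₁ * (FreeGroup.of false ^ m₂)⁻¹}

/-- In the presented group, `g₁ ^ n₁ = g₂ ^ n₂`. -/
theorem presentedGroup_of_true_zpow_left (m₁ n₁ m₂ n₂ : ℤ) :
    (PresentedGroup.of true : PresentedGroup (diskBundleRels m₁ n₁ m₂ n₂)) ^ n₁ =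
      PresentedGroup.of false ^ n₂ :=
  mul_inv_eq_one.1 (PresentedGroup.one_of_mem (rels := diskBundleRels m₁ n₁ m₂ n₂) (Or.inl rfl))

/-- In the presented group, `g₁ ^ m₁ = g₂ ^ m₂`. -/
theorem presentedGroup_of_true_zpow_right (m₁ n₁ m₂ n₂ : ℤ) :
    (PresentedGroup.of true : PresentedGroup (diskBundleRels m₁ n₁ m₂ n₂)) ^ m₁ =
      PresentedGroup.of false ^ m₂ :=
  mul_inv_eq_one.1 (PresentedGroup.one_of_mem (rels := diskBundleRels m₁ n₁ m₂ n₂) (Or.inr rfl))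

/-- If `x ^ m` and `x ^ n` are powers of `y` and `a * m + b * n = 1`, so is `x`. -/
theorem eq_zpow_of_zpow_eq_zpow {G : Type*} [Group G] {x y : G} {a b m n m' n' : ℤ}
    (hab : a * m + b * n = 1) (hn : x ^ n = y ^ n') (hm : x ^ m = y ^ m') :
    x = y ^ (a * m' + b * n') := by
  rw [← zpow_one x, ← hab, zpow_add, zpow_add, mul_comm a, mul_comm b, mul_comm a m',
    mul_comm b n', zpow_mul, zpow_mul, zpow_mul, zpow_mul, hm, hn]

/-- The presented group `⟨g₁, g₂ ∣ g₁^{n₁} = g₂^{n₂}, g₁^{m₁} = g₂^{m₂}⟩`, with `m₁, n₁`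
coprime, is cyclic of order `k = |m₁ n₂ - n₁ m₂|` (infinite cyclic if `k = 0`). -/
theorem presentedGroup_iso_zmod (m₁ n₁ m₂ n₂ : ℤ) (h : IsCoprime m₁ n₁) :
    Nonempty (PresentedGroup (diskBundleRels m₁ n₁ m₂ n₂) ≃*
      Multiplicative (ZMod (m₁ * n₂ - n₁ * m₂).natAbs)) := by
  obtain ⟨a, b, hab⟩ := h
  set k := m₁ * n₂ - n₁ * m₂ with hk
  set g₁ : PresentedGroup (diskBundleRels m₁ n₁ m₂ n₂) := PresentedGroup.of true
  set g₂ : PresentedGroup (diskBundleRels m₁ n₁ m₂ n₂) := PresentedGroup.of false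
  have hn : g₁ ^ n₁ = g₂ ^ n₂ := presentedGroup_of_true_zpow_left m₁ n₁ m₂ n₂
  have hm : g₁ ^ m₁ = g₂ ^ m₂ := presentedGroup_of_true_zpow_right m₁ n₁ m₂ n₂
  have hg : g₁ = g₂ ^ (a * m₂ + b * n₂) := eq_zpow_of_zpow_eq_zpow hab hn hm
  have hpow : g₂ ^ (k.natAbs : ℤ) = 1 := by
    rw [zpow_natCast, pow_natAbs_eq_one, hk, zpow_sub, mul_comm m₁, zpow_mul, ← hn, mul_comm n₁,
      zpow_mul g₂ m₂, ← hm, ← zpow_mul, ← zpow_mul, mul_comm, mul_inv_cancel]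
  let φ : Bool → Multiplicative (ZMod k.natAbs) := fun i =>
    .ofAdd (if i then ((a * m₂ + b * n₂ : ℤ) : ZMod k.natAbs) else 1)
  have hk0 : (k : ZMod k.natAbs) = 0 :=
    (ZMod.intCast_zmod_eq_zero_iff_dvd _ _).2 (Int.natAbs_dvd.2 dvd_rfl)
  have hφ : ∀ r ∈ diskBundleRels m₁ n₁ m₂ n₂, FreeGroup.lift φ r = 1 := by
    have hab' : (a * m₁ + b * n₁ : ZMod k.natAbs) = 1 := by
      exact_mod_cast congrArg (Int.cast : ℤ → ZMod k.natAbs) hab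
    have hk' : (m₁ * n₂ - n₁ * m₂ : ZMod k.natAbs) = 0 := by
      exact_mod_cast hk ▸ hk0
    rintro r (rfl | rfl) <;> apply Multiplicative.toAdd.injective <;>
      simp [φ]
    · linear_combination n₂ * hab' - a * hk'
    · linear_combination m₂ * hab' + b * hk'
  let f := PresentedGroup.toGroup hφ
  let ψ : Multiplicative (ZMod k.natAbs) →* PresentedGroup (diskBundleRels m₁ n₁ m₂ n₂) :=
    AddMonoidHom.toMultiplicativeLeft (ZMod.lift k.natAbs ⟨zmultiplesHom _ (Additive.ofMul g₂), by
      simpa [← ofMul_zpow] using hpow⟩)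
  have hψ (z : ℤ) : ψ (.ofAdd (z : ZMod k.natAbs)) = g₂ ^ z := by
    simp [ψ]
  have hf₁ : f g₁ = .ofAdd ((a * m₂ + b * n₂ : ℤ) : ZMod k.natAbs) := PresentedGroup.toGroup.of hφ
  have hf₂ : f g₂ = .ofAdd 1 := PresentedGroup.toGroup.of hφ
  refine ⟨f.toMulEquiv ψ (PresentedGroup.ext fun i => ?_) (MonoidHom.ext fun x => ?_)⟩
  · cases i
    · change ψ (f g₂) = g₂
      simpa [hf₂] using hψ 1
    · change ψ (f g₁) = g₁
      rw [hf₁, hψ, hg]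
  · obtain ⟨z, hz⟩ := ZMod.intCast_surjective x.toAdd
    obtain rfl : .ofAdd (z : ZMod k.natAbs) = x := congrArg _ hz
    change f (ψ _) = _
    rw [hψ, map_zpow, hf₂, ← ofAdd_zsmul, zsmul_one, MonoidHom.id_apply]
end

section
/- Let r ≥ 5 be a natural number and let v : ℤ/rℤ → ℤ × ℤ be a cyclic sequence of integer vectors, writing v i = (m_i, n_i). Assume that for every i the entries m_i and n_i are coprime, that for every i one has |m_i·n_{i+1} − m_{i+1}·n_i| = 1 (indices modulo r), and that v is normalized so that v 0 = (0, 1) and v 1 = (1, 0). Then there exist indices i, j ∈ ℤ/rℤ with j ≠ i, j ≠ i + 1, and j ≠ i − 1 such that |m_i·n_j − m_j·n_i| = 1. -/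
/-- If `a` and `b` are both unimodular with `x`, and the first coordinate of `x` has absolute
value at least two and dominates those of `a` and `b`, then `|det (a, b)| ≤ 1`. -/
theorem abs_det_le_one_of_abs_fst_le {a x b : ℤ × ℤ}
    (hax : |a.1 * x.2 - x.1 * a.2| = 1) (hxb : |x.1 * b.2 - b.1 * x.2| = 1)
    (ha : |a.1| ≤ |x.1|) (hb : |b.1| ≤ |x.1|) (hx : 2 ≤ |x.1|) :
    |a.1 * b.2 - b.1 * a.2| ≤ 1 := by
  have not_dvd_one : ¬ x.1 ∣ 1 := fun h => by
    have := Int.le_of_dvd one_pos ((abs_dvd _ _).mpr h)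
    lia
  have ha' : |a.1| ≠ |x.1| := fun h => not_dvd_one <| by
    rw [← hax, dvd_abs]
    exact dvd_sub (((abs_dvd_abs _ _).mp h.symm.dvd).mul_right _) (dvd_mul_right _ _)
  have hb' : |b.1| ≠ |x.1| := fun h => not_dvd_one <| by
    rw [← hxb, dvd_abs]
    exact dvd_sub (dvd_mul_right _ _) (((abs_dvd_abs _ _).mp h.symm.dvd).mul_right _)
  have key : |x.1| * |a.1 * b.2 - b.1 * a.2| ≤ |a.1| + |b.1| := calc
    _ = |a.1 * (x.1 * b.2 - b.1 * x.2) + b.1 * (a.1 * x.2 - x.1 * a.2)| := by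
      rw [← abs_mul]
      congr 1
      ring
    _ ≤ |a.1| * |x.1 * b.2 - b.1 * x.2| + |b.1| * |a.1 * x.2 - x.1 * a.2| := by
      simpa only [abs_mul] using abs_add_le (a.1 * (x.1 * b.2 - b.1 * x.2))
        (b.1 * (a.1 * x.2 - x.1 * a.2))
    _ = |a.1| + |b.1| := by rw [hax, hxb, mul_one, mul_one]
  by_contra! h
  have := lt_of_le_of_ne ha ha'
  have := lt_of_le_of_ne hb hb'
  nlinarith

/-- If `det (a, b) = 0` and `a`, `b` are both unimodular with `x`, then any vector unimodular
with `b` is unimodular with `a`. -/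
theorem abs_det_eq_one_of_det_eq_zero {a x b c : ℤ × ℤ}
    (hax : |a.1 * x.2 - x.1 * a.2| = 1) (hxb : |x.1 * b.2 - b.1 * x.2| = 1)
    (hbc : |b.1 * c.2 - c.1 * b.2| = 1) (hab : a.1 * b.2 - b.1 * a.2 = 0) :
    |a.1 * c.2 - c.1 * a.2| = 1 := by
  have h : (a.1 * c.2 - c.1 * a.2) * (x.1 * b.2 - b.1 * x.2) =
      -((a.1 * x.2 - x.1 * a.2) * (b.1 * c.2 - c.1 * b.2)) := by
    linear_combination (x.1 * c.2 - c.1 * x.2) * hab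
  have := congrArg abs h
  rwa [abs_neg, abs_mul, abs_mul, hax, hxb, hbc, mul_one, mul_one] at this

/-- In a cyclic sequence in which consecutive vectors are unimodular and `v 0 = (0, 1)`,
some two vectors at distance two have determinant at most one in absolute value. -/
theorem exists_abs_det_add_two_le_one (r : ℕ) [NeZero r] (v : ZMod r → ℤ × ℤ)
    (hdet : ∀ i, |(v i).1 * (v (i + 1)).2 - (v (i + 1)).1 * (v i).2| = 1)
    (h0 : v 0 = (0, 1)) :
    ∃ i, |(v i).1 * (v (i + 1 + 1)).2 - (v (i + 1 + 1)).1 * (v i).2| ≤ 1 := by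
  obtain ⟨k, hk⟩ := Finite.exists_max fun i => |(v i).1|
  rcases le_or_gt 2 |(v k).1| with h | h
  · obtain ⟨i, rfl⟩ : ∃ i, k = i + 1 := ⟨k - 1, (sub_add_cancel k 1).symm⟩
    exact ⟨i, abs_det_le_one_of_abs_fst_le (hdet i) (hdet (i + 1)) (hk _) (hk _) h⟩
  · refine ⟨0, ?_⟩
    have := hk (0 + 1 + 1)
    simp only [h0, zero_mul, mul_one, zero_sub, abs_neg]
    lia

/-- Let `r ≥ 5` and let `v : ZMod r → ℤ × ℤ`, `v i = (mᵢ, nᵢ)`, be a cyclic sequence of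
primitive integer vectors with `|mᵢ n_{i+1} - m_{i+1} nᵢ| = 1` for all `i`, normalized so
that `v 0 = (0, 1)` and `v 1 = (1, 0)`. Then there are non-adjacent indices `i, j` with
`|mᵢ nⱼ - mⱼ nᵢ| = 1`. -/
theorem exists_nonadjacent_det_one (r : ℕ) (hr : 5 ≤ r) (v : ZMod r → ℤ × ℤ)
    (hcop : ∀ i, IsCoprime (v i).1 (v i).2)
    (hdet : ∀ i, |(v i).1 * (v (i + 1)).2 - (v (i + 1)).1 * (v i).2| = 1)
    (h0 : v 0 = (0, 1)) (h1 : v 1 = (1, 0)) :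
    ∃ i j : ZMod r, j ≠ i ∧ j ≠ i + 1 ∧ j ≠ i - 1 ∧
      |(v i).1 * (v j).2 - (v j).1 * (v i).2| = 1 := by
  have ne_zero : ∀ n : ℕ, 0 < n → n < 5 → (n : ZMod r) ≠ 0 := fun n hn hn5 h => by
    have := Nat.le_of_dvd hn ((ZMod.natCast_eq_zero_iff n r).mp h)
    lia
  have : NeZero r := ⟨by lia⟩
  have n1 := ne_zero 1 (by lia) (by lia)
  have n2 := ne_zero 2 (by lia) (by lia)
  have n3 := ne_zero 3 (by lia) (by lia)
  have n4 := ne_zero 4 (by lia) (by lia)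
  push_cast at n1 n2 n3 n4
  obtain ⟨i, hi⟩ := exists_abs_det_add_two_le_one r v hdet h0
  by_cases hz : (v i).1 * (v (i + 1 + 1)).2 - (v (i + 1 + 1)).1 * (v i).2 = 0
  · refine ⟨i, i + 1 + 1 + 1, fun h => n3 ?_, fun h => n2 ?_, fun h => n4 ?_,
      abs_det_eq_one_of_det_eq_zero (hdet _) (hdet _) (hdet _) hz⟩ <;>
    linear_combination h
  · refine ⟨i, i + 1 + 1, fun h => n2 ?_, fun h => n1 ?_, fun h => n3 ?_,
      le_antisymm hi (Int.one_le_abs hz)⟩ <;>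
    linear_combination h
end
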